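/- Let F be a fragment of intuitionistic propositional logic containing →. Suppose F has a finite semantics with n ≥ 1 values, i.e., there is an algebra with finite universe V of cardinality n, carrying an operation for each connective in F, and a subset D ⊆ V, such that for all Γ ∪ {φ} ⊆ 𝔉_F, Γ ⊢_F φ iff Γ ⊨_{A,D} φ. Then the formula α_n = ∨̇_{1 ≤ i < j ≤ n+1} (p_j → p_i) — the left-associated ∨̇-combination of all implications p_j → p_i with 1 ≤ i < j ≤ n+1, where φ ∨̇ ψ abbreviates (φ → ψ) → ψ — is derivable: ⊢_F α_n. -/

import Mathlib

/-- The four propositional connectives. -/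
inductive Conn : Type
  | conj | disj | impl | nega
deriving DecidableEq

/-- Propositional formulas over countably many letters `p₀, p₁, …`. -/
inductive PropForm : Type
  | var : ℕ → PropForm
  | and : PropForm → PropForm → PropForm
  | or : PropForm → PropForm → PropForm
  | imp : PropForm → PropForm → PropForm
  | neg : PropForm → PropForm

/-- The set of connectives occurring in a formula. -/
def PropForm.conns : PropForm → Set Conn
  | .var _ => ∅
  | .and a b => insert .conj (a.conns ∪ b.conns)
  | .or a b => insert .disj (a.conns ∪ b.conns)
  | .imp a b => insert .impl (a.conns ∪ b.conns)
  | .neg a => insert .nega a.conns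

/-- `φ ∈ 𝔉_F` : the formula `φ` uses only connectives belonging to the fragment `F`. -/
def InFrag (F : Set Conn) (φ : PropForm) : Prop := φ.conns ⊆ F

/-- Derivability `Γ ⊢_F φ` for the fragment `F`: the least relation closed under
membership, monotonicity, cut, and the two directions of the rules
(R∧), (R∨), (R→), (R¬I), (R¬E) for the connectives in `F`. -/
inductive Deriv (F : Set Conn) : Set PropForm → PropForm → Prop
  | mem {Γ : Set PropForm} {φ : PropForm} : φ ∈ Γ → Deriv F Γ φ
  | mono {Γ : Set PropForm} {φ ψ : PropForm} : Deriv F Γ φ → Deriv F (insert ψ Γ) φ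
  | cut {Γ Δ : Set PropForm} {φ ψ : PropForm} :
      Deriv F Γ φ → Deriv F (insert φ Δ) ψ → Deriv F (Γ ∪ Δ) ψ
  | andI {Γ : Set PropForm} {φ ψ : PropForm} :
      Conn.conj ∈ F → Deriv F Γ φ → Deriv F Γ ψ → Deriv F Γ (.and φ ψ)
  | andE1 {Γ : Set PropForm} {φ ψ : PropForm} :
      Conn.conj ∈ F → Deriv F Γ (.and φ ψ) → Deriv F Γ φ
  | andE2 {Γ : Set PropForm} {φ ψ : PropForm} :
      Conn.conj ∈ F → Deriv F Γ (.and φ ψ) → Deriv F Γ ψ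
  | orI {Γ : Set PropForm} {φ ψ χ : PropForm} :
      Conn.disj ∈ F → Deriv F (insert φ Γ) χ → Deriv F (insert ψ Γ) χ →
      Deriv F (insert (.or φ ψ) Γ) χ
  | orE1 {Γ : Set PropForm} {φ ψ χ : PropForm} :
      Conn.disj ∈ F → Deriv F (insert (.or φ ψ) Γ) χ → Deriv F (insert φ Γ) χ
  | orE2 {Γ : Set PropForm} {φ ψ χ : PropForm} :
      Conn.disj ∈ F → Deriv F (insert (.or φ ψ) Γ) χ → Deriv F (insert ψ Γ) χ
  | impI {Γ : Set PropForm} {φ ψ : PropForm} :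
      Conn.impl ∈ F → Deriv F (insert φ Γ) ψ → Deriv F Γ (.imp φ ψ)
  | impE {Γ : Set PropForm} {φ ψ : PropForm} :
      Conn.impl ∈ F → Deriv F Γ (.imp φ ψ) → Deriv F (insert φ Γ) ψ
  | negI {Γ : Set PropForm} {φ ψ : PropForm} :
      Conn.nega ∈ F → Deriv F (insert φ Γ) ψ → Deriv F (insert φ Γ) (.neg ψ) →
      Deriv F Γ (.neg φ)
  | negE {Γ : Set PropForm} {φ ψ : PropForm} :
      Conn.nega ∈ F → Deriv F Γ φ → Deriv F Γ (.neg φ) → Deriv F Γ ψ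

/-- An algebra interpreting the connectives on a carrier `V`. -/
structure Alg (V : Type) where
  and : V → V → V
  or : V → V → V
  imp : V → V → V
  neg : V → V

/-- The homomorphic extension of an assignment `v` of letters. -/
def Alg.eval {V : Type} (A : Alg V) (v : ℕ → V) : PropForm → V
  | .var n => v n
  | .and a b => A.and (A.eval v a) (A.eval v b)
  | .or a b => A.or (A.eval v a) (A.eval v b)
  | .imp a b => A.imp (A.eval v a) (A.eval v b)
  | .neg a => A.neg (A.eval v a)

/-- Semantic consequence `Γ ⊨_{A,D} φ`. -/
def SemConseq {V : Type} (A : Alg V) (D : Set V) (Γ : Set PropForm) (φ : PropForm) : Prop :=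
  ∀ v : ℕ → V, (∀ ψ ∈ Γ, A.eval v ψ ∈ D) → A.eval v φ ∈ D

/-- The fragment `F` has a finite semantics. -/
def HasFiniteSemantics (F : Set Conn) : Prop :=
  ∃ (V : Type) (_ : Fintype V) (A : Alg V) (D : Set V),
    ∀ (Γ : Set PropForm) (φ : PropForm),
      (∀ ψ ∈ Γ, InFrag F ψ) → InFrag F φ →
      (Deriv F Γ φ ↔ SemConseq A D Γ φ)

/-- `φ ∨̇ ψ = (φ → ψ) → ψ`. -/
def dvee (a b : PropForm) : PropForm := .imp (.imp a b) b

/-- Left-associated iterated `∨̇` of a list of formulas. -/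
def bigDvee : List PropForm → PropForm
  | [] => .var 0
  | a :: rest => rest.foldl dvee a

/-- Left-associated iterated `∨` of a list of formulas. -/
def bigOrF : List PropForm → PropForm
  | [] => .var 0
  | a :: rest => rest.foldl PropForm.or a

/-- All pairs `(i, j)` with `1 ≤ i < j ≤ n+1`. -/
def pairs (n : ℕ) : List (ℕ × ℕ) :=
  (List.range' 2 n).flatMap fun j => (List.range' 1 (j - 1)).map fun i => (i, j)

/-- `α_n = ∨̇_{1 ≤ i < j ≤ n+1} (p_j → p_i)`. -/
def alphaImp (n : ℕ) : PropForm :=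
  bigDvee ((pairs n).map fun p => .imp (.var p.2) (.var p.1))

/-- `α_n = ⋁_{1 ≤ i < j ≤ n+1} ¬¬(¬p_i ∨ p_j)`. -/
def alphaOrNeg (n : ℕ) : PropForm :=
  bigOrF ((pairs n).map fun p => .neg (.neg (.or (.neg (.var p.1)) (.var p.2))))

/-- Two-valued Boolean evaluation. -/
def evalBool (v : ℕ → Bool) : PropForm → Bool
  | .var n => v n
  | .and a b => evalBool v a && evalBool v b
  | .or a b => evalBool v a || evalBool v b
  | .imp a b => !evalBool v a || evalBool v b
  | .neg a => !evalBool v a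

/-- Classical (two-valued) consequence `Γ ⊢_c φ`. -/
def ClassConseq (Γ : Set PropForm) (φ : PropForm) : Prop :=
  ∀ v : ℕ → Bool, (∀ ψ ∈ Γ, evalBool v ψ = true) → evalBool v φ = true

/-- The two-element Boolean algebra `𝟐`. -/
def alg2 : Alg Bool where
  and a b := a && b
  or a b := a || b
  imp a b := !a || b
  neg a := !a

/-- The three-element algebra `𝟑` on the chain `0 < 1/2 < 1` (coded as `0 < 1 < 2` in `Fin 3`),
with meet `min` and meet complement `¬0 = 1`, `¬(1/2) = ¬1 = 0` (its `or`/`imp` are those of the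
3-element Heyting chain). -/
def alg3 : Alg (Fin 3) where
  and a b := min a b
  or a b := max a b
  imp a b := if a ≤ b then 2 else b
  neg a := if a = 0 then 2 else 0

/-- The `(n+1)`-element Heyting chain, coded on `Fin (n+1)` (so `k` codes the element `k+1`). -/
def chainAlg (n : ℕ) : Alg (Fin (n + 1)) where
  and a b := min a b
  or a b := max a b
  imp a b := if a ≤ b then Fin.last n else b
  neg a := if a = 0 then Fin.last n else 0

theorem inFrag_imp {F : Set Conn} (hF : Conn.impl ∈ F) {φ ψ : PropForm}
    (hφ : InFrag F φ) (hψ : InFrag F ψ) : InFrag F (.imp φ ψ) :=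
  Set.insert_subset hF (Set.union_subset hφ hψ)

theorem inFrag_foldl_dvee {F : Set Conn} (hF : Conn.impl ∈ F) {l : List PropForm} {φ : PropForm}
    (hφ : InFrag F φ) (hl : ∀ ψ ∈ l, InFrag F ψ) : InFrag F (l.foldl dvee φ) := by
  induction l generalizing φ with
  | nil => exact hφ
  | cons ψ l ih =>
    rw [List.forall_mem_cons] at hl
    exact ih (inFrag_imp hF (inFrag_imp hF hφ hl.1) hl.1) hl.2

theorem inFrag_bigDvee {F : Set Conn} (hF : Conn.impl ∈ F) {l : List PropForm}
    (hl : ∀ ψ ∈ l, InFrag F ψ) : InFrag F (bigDvee l) := by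
  cases l with
  | nil => exact Set.empty_subset _
  | cons φ l =>
    rw [List.forall_mem_cons] at hl
    exact inFrag_foldl_dvee hF hl.1 hl.2

theorem Deriv.dvee_left {F : Set Conn} (hF : Conn.impl ∈ F) {Γ : Set PropForm} {φ ψ : PropForm}
    (h : Deriv F Γ φ) : Deriv F Γ (dvee φ ψ) := by
  refine .impI hF ?_
  have hψ : Deriv F (insert φ (insert (.imp φ ψ) Γ)) ψ :=
    .impE hF (.mem (Set.mem_insert _ _))
  simpa using h.cut hψ

theorem Deriv.dvee_right {F : Set Conn} (hF : Conn.impl ∈ F) {Γ : Set PropForm} {φ ψ : PropForm}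
    (h : Deriv F Γ ψ) : Deriv F Γ (dvee φ ψ) :=
  .impI hF h.mono

theorem Deriv.foldl_dvee {F : Set Conn} (hF : Conn.impl ∈ F) {Γ : Set PropForm}
    {l : List PropForm} {φ : PropForm} (h : Deriv F Γ φ ∨ ∃ ψ ∈ l, Deriv F Γ ψ) :
    Deriv F Γ (l.foldl dvee φ) := by
  induction l generalizing φ with
  | nil => simpa using h
  | cons ψ l ih =>
    refine ih ?_
    rw [List.exists_mem_cons_iff] at h
    rcases h with h | h | h
    · exact .inl (h.dvee_left hF)
    · exact .inl (h.dvee_right hF)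
    · exact .inr h

/-- If one member of a list is derivable, so is the iterated `∨̇` of the list. -/
theorem Deriv.bigDvee {F : Set Conn} (hF : Conn.impl ∈ F) {Γ : Set PropForm}
    {l : List PropForm} {φ : PropForm} (hφ : φ ∈ l) (h : Deriv F Γ φ) :
    Deriv F Γ (bigDvee l) := by
  cases l with
  | nil => simp at hφ
  | cons ψ l =>
    rcases List.mem_cons.1 hφ with rfl | hφ
    · exact .foldl_dvee hF (.inl h)
    · exact .foldl_dvee hF (.inr ⟨φ, hφ, h⟩)

theorem eval_foldl_dvee_map_congr {V ι : Type} {A : Alg V} {v : ℕ → V} {f g : ι → PropForm}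
    (hfg : ∀ x, A.eval v (f x) = A.eval v (g x)) (l : List ι) {φ ψ : PropForm}
    (h : A.eval v φ = A.eval v ψ) :
    A.eval v ((l.map f).foldl dvee φ) = A.eval v ((l.map g).foldl dvee ψ) := by
  induction l generalizing φ ψ with
  | nil => exact h
  | cons x l ih => exact ih (by simp only [dvee, Alg.eval, h, hfg])

theorem eval_bigDvee_map_congr {V ι : Type} {A : Alg V} {v : ℕ → V} {f g : ι → PropForm}
    (hfg : ∀ x, A.eval v (f x) = A.eval v (g x)) {l : List ι} :
    A.eval v (bigDvee (l.map f)) = A.eval v (bigDvee (l.map g)) := by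
  cases l with
  | nil => rfl
  | cons x l => exact eval_foldl_dvee_map_congr hfg l (hfg x)

theorem mem_pairs {n i j : ℕ} : (i, j) ∈ pairs n ↔ 1 ≤ i ∧ i < j ∧ j ≤ n + 1 := by
  simp only [pairs, List.mem_flatMap, List.mem_map, List.mem_range'_1, Prod.mk.injEq]
  constructor
  · rintro ⟨_, _, _, _, rfl, rfl⟩
    omega
  · intro _
    exact ⟨j, by omega, i, by omega, rfl, rfl⟩

/-- if `→ ∈ F` and `F` has a finite semantics with `n ≥ 1` values,
then `⊢_F α_n` where `α_n = ∨̇_{1 ≤ i < j ≤ n+1} (p_j → p_i)`. -/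
theorem finite_semantics_imp_alpha (F : Set Conn) (hF : Conn.impl ∈ F) (n : ℕ) (hn : 1 ≤ n)
    (V : Type) [instV : Fintype V] (hcard : Fintype.card V = n) (A : Alg V) (D : Set V)
    (hsem : ∀ (Γ : Set PropForm) (φ : PropForm),
      (∀ ψ ∈ Γ, InFrag F ψ) → InFrag F φ → (Deriv F Γ φ ↔ SemConseq A D Γ φ)) :
    Deriv F ∅ (alphaImp n) := by
  have hfrag (s : ℕ → ℕ) :
      InFrag F (bigDvee ((pairs n).map fun p => .imp (.var (s p.2)) (.var (s p.1)))) := by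
    refine inFrag_bigDvee hF fun φ hφ => ?_
    obtain ⟨p, -, rfl⟩ := List.mem_map.1 hφ
    exact inFrag_imp hF (Set.empty_subset _) (Set.empty_subset _)
  rw [hsem ∅ (alphaImp n) (by simp) (hfrag id)]
  intro v hv
  obtain ⟨i, j, hij, hvij⟩ : ∃ i j, (i, j) ∈ pairs n ∧ v i = v j := by
    obtain ⟨x, hx, y, hy, hxy, hvxy⟩ := Finset.exists_ne_map_eq_of_card_lt_of_maps_to
      (s := Finset.Icc 1 (n + 1)) (t := Finset.univ) (f := v) (by simp [hcard]) (by simp)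
    rw [Finset.mem_Icc] at hx hy
    rcases hxy.lt_or_gt with h | h
    · exact ⟨x, y, mem_pairs.2 ⟨hx.1, h, hy.2⟩, hvxy⟩
    · exact ⟨y, x, mem_pairs.2 ⟨hy.1, h, hx.2⟩, hvxy.symm⟩
  let s : ℕ → ℕ := Function.update id j i
  have hs (k : ℕ) : v (s k) = v k := by
    by_cases hk : k = j
    · subst hk; simp [s, hvij]
    · simp [s, hk]
  have hder : Deriv F ∅
      (bigDvee ((pairs n).map fun p => .imp (.var (s p.2)) (.var (s p.1)))) := by
    refine Deriv.bigDvee hF (List.mem_map.2 ⟨(i, j), hij, rfl⟩) ?_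
    have hi : s i = s j := by
      simp [s, Function.update_apply]
    rw [hi]
    exact .impI hF (.mem (Set.mem_insert _ _))
  have hD := (hsem ∅ _ (by simp) (hfrag s)).1 hder v (by simp)
  rwa [eval_bigDvee_map_congr (g := fun p => .imp (.var p.2) (.var p.1))
    (fun p => by simp only [Alg.eval, hs])] at hD
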